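/- (Triviality of the kernel of the linearized operator.) Let γ and α be real and ε₁ > 0. Consider triples (w₁, w₂, w₃) of functions on the closed strip ℝ×[0,1] that are bounded with bounded first-order partial derivatives, continuously differentiable on the closed strip, harmonic in R, vanish identically on B, and satisfy on Γ the three conditions: γ·w₁ + w₂ = 0; ∂_y w₂ + (γ − 1 − ε₁)·∂_y w₁ + (γ + α)·w₁ + ε₁·∂_y w₃ = 0; and w₃ = 0. Then the only such triple is (0, 0, 0) if and only if α < 1 − γ + ε₁. -/

import Mathlib

/-- The closed strip `ℝ × [0,1]`. -/
def strip : Set (ℝ × ℝ) := {p : ℝ × ℝ | p.2 ∈ Set.Icc (0 : ℝ) 1}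

/-- The open strip `R = ℝ × (0,1)`. -/
def stripO : Set (ℝ × ℝ) := {p : ℝ × ℝ | p.2 ∈ Set.Ioo (0 : ℝ) 1}

/-- Partial derivative in the first (horizontal) variable, taken within the closed strip
(at interior points it agrees with the usual partial derivative; on the boundary it is
the one-sided partial derivative). -/
noncomputable def pdx (f : ℝ × ℝ → ℝ) (p : ℝ × ℝ) : ℝ := fderivWithin ℝ f strip p (1, 0)

/-- Partial derivative in the second (vertical) variable, taken within the closed strip. -/
noncomputable def pdy (f : ℝ × ℝ → ℝ) (p : ℝ × ℝ) : ℝ := fderivWithin ℝ f strip p (0, 1)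

open Filter Topology Set

/-- Harmonicity in the open strip, expressed through derivatives along coordinate lines. -/
def SliceHarmonic (u : ℝ × ℝ → ℝ) : Prop :=
  ∃ ux uy uxx uyy : ℝ × ℝ → ℝ, ∀ p ∈ stripO,
    HasDerivAt (fun t => u (t, p.2)) (ux p) p.1 ∧ HasDerivAt (fun t => ux (t, p.2)) (uxx p) p.1 ∧
    HasDerivAt (fun t => u (p.1, t)) (uy p) p.2 ∧ HasDerivAt (fun t => uy (p.1, t)) (uyy p) p.2 ∧
    uxx p + uyy p = 0

theorem SliceHarmonic.const_mul_add {u v : ℝ × ℝ → ℝ} (hu : SliceHarmonic u)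
    (hv : SliceHarmonic v) (a : ℝ) : SliceHarmonic (fun p => a * u p + v p) := by
  obtain ⟨ux, uy, uxx, uyy, hu⟩ := hu
  obtain ⟨vx, vy, vxx, vyy, hv⟩ := hv
  refine ⟨fun p => a * ux p + vx p, fun p => a * uy p + vy p, fun p => a * uxx p + vxx p,
    fun p => a * uyy p + vyy p, fun p hp => ?_⟩
  obtain ⟨h1, h2, h3, h4, h5⟩ := hu p hp
  obtain ⟨k1, k2, k3, k4, k5⟩ := hv p hp
  exact ⟨(h1.const_mul a).add k1, (h2.const_mul a).add k2, (h3.const_mul a).add k3,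
    (h4.const_mul a).add k4, by linear_combination a * h5 + k5⟩

theorem SliceHarmonic.neg {u : ℝ × ℝ → ℝ} (hu : SliceHarmonic u) :
    SliceHarmonic (fun p => -u p) := by
  obtain ⟨ux, uy, uxx, uyy, hu⟩ := hu
  refine ⟨fun p => -ux p, fun p => -uy p, fun p => -uxx p, fun p => -uyy p, fun p hp => ?_⟩
  obtain ⟨h1, h2, h3, h4, h5⟩ := hu p hp
  exact ⟨h1.neg, h2.neg, h3.neg, h4.neg, by linear_combination -h5⟩

theorem isOpen_stripO : IsOpen stripO := isOpen_Ioo.preimage continuous_snd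

theorem isClosed_strip : IsClosed strip := isClosed_Icc.preimage continuous_snd

theorem stripO_subset_strip : stripO ⊆ strip := fun _ hp => Ioo_subset_Icc_self hp

theorem strip_mem_nhds {p : ℝ × ℝ} (hp : p ∈ stripO) : strip ∈ 𝓝 p :=
  mem_of_superset (isOpen_stripO.mem_nhds hp) stripO_subset_strip

theorem uniqueDiffOn_strip : UniqueDiffOn ℝ strip := by
  have h : strip = univ ×ˢ Icc (0 : ℝ) 1 := by ext p; simp [strip]
  rw [h]
  exact uniqueDiffOn_univ.prod (uniqueDiffOn_Icc one_pos)

theorem hasDerivAt_mk_left (x y : ℝ) : HasDerivAt (fun t : ℝ => (t, y)) ((1 : ℝ), (0 : ℝ)) x :=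
  (hasDerivAt_id x).prodMk (hasDerivAt_const x y)

theorem hasDerivAt_mk_right (x y : ℝ) : HasDerivAt (fun t : ℝ => (x, t)) ((0 : ℝ), (1 : ℝ)) y :=
  (hasDerivAt_const y x).prodMk (hasDerivAt_id y)

theorem hasDerivAt_pdx {f : ℝ × ℝ → ℝ} {p : ℝ × ℝ} (hp : p ∈ stripO)
    (hf : DifferentiableAt ℝ f p) : HasDerivAt (fun t => f (t, p.2)) (pdx f p) p.1 := by
  rw [pdx, fderivWithin_of_mem_nhds (strip_mem_nhds hp)]
  exact HasFDerivAt.comp_hasDerivAt p.1 (l := f) hf.hasFDerivAt (hasDerivAt_mk_left p.1 p.2)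

theorem hasDerivAt_pdy {f : ℝ × ℝ → ℝ} {p : ℝ × ℝ} (hp : p ∈ stripO)
    (hf : DifferentiableAt ℝ f p) : HasDerivAt (fun t => f (p.1, t)) (pdy f p) p.2 := by
  rw [pdy, fderivWithin_of_mem_nhds (strip_mem_nhds hp)]
  exact HasFDerivAt.comp_hasDerivAt p.2 (l := f) hf.hasFDerivAt (hasDerivAt_mk_right p.1 p.2)

theorem hasDerivWithinAt_pdy {f : ℝ × ℝ → ℝ} {p : ℝ × ℝ}
    (hf : DifferentiableWithinAt ℝ f strip p) :
    HasDerivWithinAt (fun t => f (p.1, t)) (pdy f p) (Icc 0 1) p.2 :=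
  HasFDerivWithinAt.comp_hasDerivWithinAt (t := strip) p.2 (l := f) hf.hasFDerivWithinAt
    (hasDerivAt_mk_right p.1 p.2).hasDerivWithinAt (fun _ ht => ht)

theorem differentiableAt_fderivWithin_apply {f : ℝ × ℝ → ℝ} (hf : ContDiffOn ℝ 2 f stripO)
    {p : ℝ × ℝ} (hp : p ∈ stripO) (v : ℝ × ℝ) :
    DifferentiableAt ℝ (fun q => fderivWithin ℝ f strip q v) p := by
  have h1 : ContDiffOn ℝ 1 (fderiv ℝ f) stripO :=
    hf.fderiv_of_isOpen isOpen_stripO (by norm_num)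
  have h2 : DifferentiableAt ℝ (fun q => fderiv ℝ f q v) p :=
    ((h1.contDiffAt (isOpen_stripO.mem_nhds hp)).differentiableAt (by norm_num)).clm_apply
      (differentiableAt_const v)
  refine h2.congr_of_eventuallyEq ?_
  filter_upwards [isOpen_stripO.mem_nhds hp] with q hq
  rw [fderivWithin_of_mem_nhds (strip_mem_nhds hq)]

theorem sliceHarmonic_of_contDiffOn {f : ℝ × ℝ → ℝ} (hf : ContDiffOn ℝ 2 f stripO)
    (h : ∀ p ∈ stripO, pdx (pdx f) p + pdy (pdy f) p = 0) : SliceHarmonic f := by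
  refine ⟨pdx f, pdy f, pdx (pdx f), pdy (pdy f), fun p hp => ?_⟩
  have hd : DifferentiableAt ℝ f p :=
    (hf.contDiffAt (isOpen_stripO.mem_nhds hp)).differentiableAt (by norm_num)
  exact ⟨hasDerivAt_pdx hp hd,
    hasDerivAt_pdx hp (differentiableAt_fderivWithin_apply hf hp (1, 0)),
    hasDerivAt_pdy hp hd,
    hasDerivAt_pdy hp (differentiableAt_fderivWithin_apply hf hp (0, 1)), h p hp⟩

/-- Second derivative test, necessary condition. -/
theorem IsLocalMax.second_deriv_nonpos {f f' : ℝ → ℝ} {a b : ℝ} (hmax : IsLocalMax f a)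
    (hf : ∀ᶠ t in 𝓝 a, HasDerivAt f (f' t) t) (hf' : HasDerivAt f' b a) : b ≤ 0 := by
  by_contra! hb
  have hd : deriv f =ᶠ[𝓝 a] f' := hf.mono fun t ht => ht.deriv
  have hdd : deriv (deriv f) a = b := by rw [hd.deriv_eq, hf'.deriv]
  have hmin : IsLocalMin f a := isLocalMin_of_deriv_deriv_pos (hdd ▸ hb) hmax.deriv_eq_zero
    hf.self_of_nhds.continuousAt
  have hc : f =ᶠ[𝓝 a] fun _ => f a := by
    filter_upwards [hmax, hmin] with t h1 h2 using le_antisymm h1 h2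
  have h0 : deriv (deriv f) a = 0 := by
    rw [hc.deriv.deriv_eq]
    simp
  linarith

theorem HasDerivWithinAt.nonneg_of_isMaxOn_right {f : ℝ → ℝ} {d : ℝ}
    (hf : HasDerivWithinAt f d (Icc 0 1) 1) (hmax : ∀ t ∈ Icc (0 : ℝ) 1, f t ≤ f 1) : 0 ≤ d := by
  have h := (hasDerivWithinAt_iff_tendsto_slope' (by simp)).1 (hf.mono Ico_subset_Icc_self)
  have : NeBot (𝓝[Ico (0 : ℝ) 1] 1) := by
    rw [nhdsWithin_Ico_eq_nhdsLT one_pos]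
    infer_instance
  refine ge_of_tendsto h ?_
  filter_upwards [self_mem_nhdsWithin] with t ht
  rw [slope_def_field]
  exact div_nonneg_of_nonpos (by linarith [hmax t (Ico_subset_Icc_self ht)]) (by linarith [ht.2])

/-- The transversal profile of the barrier function `barrier`. -/
def profile (δ y : ℝ) : ℝ := y + 2 * δ ^ 2 * (1 - y ^ 2)

/-- A positive strictly superharmonic function on the strip growing exponentially. -/
noncomputable def barrier (δ : ℝ) (p : ℝ × ℝ) : ℝ := Real.cosh (δ * p.1) * profile δ p.2

theorem two_mul_sq_le_profile {δ y : ℝ} (hδ' : 2 * δ ^ 2 ≤ 1) (hy : y ∈ Icc (0 : ℝ) 1) :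
    2 * δ ^ 2 ≤ profile δ y := by
  obtain ⟨h0, h1⟩ := hy
  unfold profile
  nlinarith [mul_nonneg (sq_nonneg δ) (mul_nonneg h0 (sub_nonneg.2 h1)),
    mul_nonneg h0 (sub_nonneg.2 hδ')]

theorem profile_lt_four {δ y : ℝ} (hδ' : 2 * δ ^ 2 ≤ 1) (hy : y ∈ Icc (0 : ℝ) 1) :
    profile δ y < 4 := by
  obtain ⟨h0, h1⟩ := hy
  unfold profile
  nlinarith [mul_nonneg (sq_nonneg δ) (sq_nonneg y)]

theorem barrier_pos {δ : ℝ} (hδ : 0 < δ) (hδ' : 2 * δ ^ 2 ≤ 1) {p : ℝ × ℝ} (hp : p ∈ strip) :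
    0 < barrier δ p :=
  mul_pos (Real.cosh_pos _) ((by positivity : 0 < 2 * δ ^ 2).trans_le
    (two_mul_sq_le_profile hδ' hp))

theorem hasDerivAt_profile (δ y : ℝ) : HasDerivAt (profile δ) (1 - 4 * δ ^ 2 * y) y := by
  have h := (hasDerivAt_id y).add
    ((((hasDerivAt_id y).pow 2).const_sub 1).const_mul (2 * δ ^ 2))
  exact h.congr_deriv (by simp; ring)

theorem continuous_barrier (δ : ℝ) : Continuous (barrier δ) := by
  unfold barrier profile
  fun_prop

theorem abs_div_two_le_cosh (x : ℝ) : |x| / 2 ≤ Real.cosh x := by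
  rw [← Real.cosh_abs, Real.cosh_eq]
  linarith [Real.add_one_le_exp |x|, Real.exp_pos (-|x|)]

theorem exists_isMaxOn_div_barrier {u : ℝ × ℝ → ℝ} (hu : ContinuousOn u strip) {K : ℝ}
    (hK : ∀ p ∈ strip, u p ≤ K) {δ : ℝ} (hδ : 0 < δ) (hδ' : 2 * δ ^ 2 ≤ 1)
    {p₀ : ℝ × ℝ} (hp₀ : p₀ ∈ strip) (hpos : 0 < u p₀) :
    ∃ q ∈ strip, IsMaxOn (fun p => u p / barrier δ p) strip q := by
  refine ContinuousOn.exists_isMaxOn' (hu.div (continuous_barrier δ).continuousOn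
    fun p hp => (barrier_pos hδ hδ' hp).ne') isClosed_strip hp₀ ?_
  set m := u p₀ / barrier δ p₀ with hm
  have hm0 : 0 < m := div_pos hpos (barrier_pos hδ hδ' hp₀)
  have hcpt : IsCompact (Icc (-(K / (m * δ ^ 3))) (K / (m * δ ^ 3)) ×ˢ Icc (0 : ℝ) 1) :=
    isCompact_Icc.prod isCompact_Icc
  rw [eventually_inf_principal]
  filter_upwards [hcpt.compl_mem_cocompact] with p hp hps
  have hx : K / (m * δ ^ 3) < |p.1| := by
    by_contra! h
    exact hp ⟨abs_le.1 h, hps⟩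
  rw [div_le_iff₀ (barrier_pos hδ hδ' hps)]
  have h1 : K < |p.1| * (m * δ ^ 3) := (div_lt_iff₀ (by positivity)).1 hx
  have h2 : δ * |p.1| / 2 ≤ Real.cosh (δ * p.1) := by
    have := abs_div_two_le_cosh (δ * p.1)
    rwa [abs_mul, abs_of_pos hδ] at this
  have h3 : δ * |p.1| / 2 * (2 * δ ^ 2) ≤ barrier δ p :=
    mul_le_mul h2 (two_mul_sq_le_profile hδ' hps) (by positivity) (Real.cosh_pos _).le
  nlinarith [hK p hps, mul_le_mul_of_nonneg_left h3 hm0.le]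

/-- Maximum principle in the strip with a Dirichlet condition on the lower boundary and, on the
upper boundary, either a Dirichlet condition or a Robin condition with coefficient `c < 1`. -/
theorem SliceHarmonic.nonpos {u : ℝ × ℝ → ℝ} (hu : SliceHarmonic u) (hc : ContinuousOn u strip)
    {K : ℝ} (hK : ∀ p ∈ strip, u p ≤ K) (h0 : ∀ x, u (x, 0) = 0) {c : ℝ} (hc1 : c < 1)
    (h1 : ∀ x, u (x, 1) = 0 ∨
      HasDerivWithinAt (fun t => u (x, t)) (c * u (x, 1)) (Icc 0 1) 1) :
    ∀ p ∈ strip, u p ≤ 0 := by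
  by_contra! hcon
  obtain ⟨p₀, hp₀, hpos⟩ := hcon
  obtain ⟨δ, hδ, hδ', hδc⟩ : ∃ δ : ℝ, 0 < δ ∧ 2 * δ ^ 2 ≤ 1 ∧ 4 * δ ^ 2 < 1 - c := by
    have hd : 0 < min (1 / 2) ((1 - c) / 5) := lt_min (by norm_num) (by linarith)
    refine ⟨_, hd, ?_, ?_⟩ <;>
      nlinarith [min_le_left (1 / 2) ((1 - c) / 5), min_le_right (1 / 2) ((1 - c) / 5)]
  obtain ⟨q, hq, hmax⟩ := exists_isMaxOn_div_barrier hc hK hδ hδ' hp₀ hpos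
  set M := u q / barrier δ q with hM
  have hM0 : 0 < M := (div_pos hpos (barrier_pos hδ hδ' hp₀)).trans_le (hmax hp₀)
  have hle : ∀ p ∈ strip, u p - M * barrier δ p ≤ 0 := fun p hp =>
    sub_nonpos.2 ((div_le_iff₀ (barrier_pos hδ hδ' hp)).1 (hmax hp))
  have heq : u q = M * barrier δ q := (div_mul_cancel₀ _ (barrier_pos hδ hδ' hq).ne').symm
  have huq : 0 < u q := heq ▸ mul_pos hM0 (barrier_pos hδ hδ' hq)
  obtain ⟨x, y⟩ := q
  have hcosh : 0 < Real.cosh (δ * x) := Real.cosh_pos _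
  have hby (t : ℝ) : HasDerivAt (fun t => M * barrier δ (x, t))
      (M * (Real.cosh (δ * x) * (1 - 4 * δ ^ 2 * t))) t :=
    ((hasDerivAt_profile δ t).const_mul (Real.cosh (δ * x))).const_mul M
  rcases eq_or_ne y 0 with rfl | hy0
  · exact huq.ne' (h0 x)
  rcases eq_or_ne y 1 with rfl | hy1
  · rcases h1 x with h | h
    · exact huq.ne' h
    have hd := (h.sub (hby 1).hasDerivWithinAt).nonneg_of_isMaxOn_right fun t ht => by
      simpa [heq] using hle (x, t) ht
    have hb : barrier δ (x, 1) = Real.cosh (δ * x) := by simp [barrier, profile]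
    rw [heq, hb] at hd
    nlinarith [mul_pos hM0 hcosh]
  have hyI : y ∈ Ioo (0 : ℝ) 1 := ⟨lt_of_le_of_ne hq.1 hy0.symm, lt_of_le_of_ne hq.2 hy1⟩
  obtain ⟨ux, uy, uxx, uyy, hu⟩ := hu
  obtain ⟨-, hxx, -, hyy, hlap⟩ := hu (x, y) hyI
  have hcx (t : ℝ) : HasDerivAt (fun t => Real.cosh (δ * t)) (δ * Real.sinh (δ * t)) t := by
    simpa [mul_comm] using ((hasDerivAt_id t).const_mul δ).cosh
  have hsx (t : ℝ) : HasDerivAt (fun t => Real.sinh (δ * t)) (δ * Real.cosh (δ * t)) t := by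
    simpa [mul_comm] using ((hasDerivAt_id t).const_mul δ).sinh
  have hX : uxx (x, y) - M * (δ * (δ * Real.cosh (δ * x)) * profile δ y) ≤ 0 := by
    refine IsLocalMax.second_deriv_nonpos (f := fun t => u (t, y) - M * barrier δ (t, y))
      (Eventually.of_forall fun t => ?_) (Eventually.of_forall fun t => ?_)
      (hxx.sub ((((hsx x).const_mul δ).mul_const (profile δ y)).const_mul M))
    · simpa [heq] using hle (t, y) hq
    · exact (hu (t, y) hyI).1.sub (((hcx t).mul_const (profile δ y)).const_mul M)
  have hY : uyy (x, y) - M * (Real.cosh (δ * x) * (-(4 * δ ^ 2))) ≤ 0 := by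
    have hl : HasDerivAt (fun t => 1 - 4 * δ ^ 2 * t) (-(4 * δ ^ 2)) y := by
      simpa using ((hasDerivAt_id y).const_mul (4 * δ ^ 2)).const_sub 1
    refine IsLocalMax.second_deriv_nonpos (f := fun t => u (x, t) - M * barrier δ (x, t))
      ?_ ?_ (hyy.sub ((hl.const_mul (Real.cosh (δ * x))).const_mul M))
    · filter_upwards [isOpen_Ioo.mem_nhds hyI] with t ht
      simpa [heq] using hle (x, t) (Ioo_subset_Icc_self ht)
    · filter_upwards [isOpen_Ioo.mem_nhds hyI] with t ht
      exact (hu (x, t) ht).2.2.1.sub (hby t)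
  have hlt : 0 < M * Real.cosh (δ * x) * δ ^ 2 * (4 - profile δ y) :=
    mul_pos (by positivity) (sub_pos.2 (profile_lt_four hδ' hq))
  nlinarith

theorem SliceHarmonic.eq_zero {u : ℝ × ℝ → ℝ} (hu : SliceHarmonic u) (hc : ContinuousOn u strip)
    {K : ℝ} (hK : ∀ p ∈ strip, |u p| ≤ K) (h0 : ∀ x, u (x, 0) = 0) {c : ℝ} (hc1 : c < 1)
    (h1 : ∀ x, u (x, 1) = 0 ∨
      HasDerivWithinAt (fun t => u (x, t)) (c * u (x, 1)) (Icc 0 1) 1) :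
    ∀ p ∈ strip, u p = 0 := by
  intro p hp
  refine le_antisymm (hu.nonpos hc (fun p hp => (abs_le.1 (hK p hp)).2) h0 hc1 h1 p hp) ?_
  refine neg_nonpos.1 (hu.neg.nonpos hc.neg (K := K)
    (fun p hp => by linarith [(abs_le.1 (hK p hp)).1]) (by simpa using h0) hc1 (fun x => ?_) p hp)
  refine (h1 x).imp (fun h => by simpa using h) fun h => ?_
  simpa using h.fun_neg

theorem exists_mul_cosh_eq_mul_sinh {c : ℝ} (hc : 1 < c) :
    ∃ k : ℝ, 0 < k ∧ k * Real.cosh k = c * Real.sinh k := by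
  have hev : ∀ᶠ k in 𝓝[>] (0 : ℝ), Real.cosh k < c :=
    (Real.continuous_cosh.continuousAt.eventually_lt continuousAt_const
      (by simpa using hc)).filter_mono nhdsWithin_le_nhds
  obtain ⟨a, hac, ha0, ha1⟩ := (hev.and (Ioo_mem_nhdsGT one_pos)).exists
  have ha : 0 < a := ha0
  have hsa : a < Real.sinh a := Real.self_lt_sinh_iff.2 ha
  have hcont : ContinuousOn (fun k => k * Real.cosh k - c * Real.sinh k) (Icc a c) := by fun_prop
  obtain ⟨k, hk, hk0⟩ := intermediate_value_Icc (by linarith) hcont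
    (show (0 : ℝ) ∈ Icc _ _ from
      ⟨by nlinarith, by nlinarith [Real.sinh_lt_cosh c]⟩)
  exact ⟨k, ha.trans_le hk.1, by linarith [hk0]⟩

theorem exists_transversal_mode {c : ℝ} (hc : 1 ≤ c) :
    ∃ (k : ℝ) (Y Y' : ℝ → ℝ), ContDiff ℝ 2 Y ∧ (∀ t, HasDerivAt Y (Y' t) t) ∧
      (∀ t, HasDerivAt Y' (k ^ 2 * Y t) t) ∧ Y 0 = 0 ∧ Y 1 ≠ 0 ∧ Y' 1 = c * Y 1 := by
  rcases hc.eq_or_lt with rfl | hc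
  · exact ⟨0, id, fun _ => 1, contDiff_id, hasDerivAt_id,
      fun t => by simpa using hasDerivAt_const t (1 : ℝ), by simp⟩
  obtain ⟨k, hk, hkc⟩ := exists_mul_cosh_eq_mul_sinh hc
  refine ⟨k, fun t => Real.sinh (k * t), fun t => k * Real.cosh (k * t),
    Real.contDiff_sinh.comp (contDiff_const.mul contDiff_id), fun t => ?_, fun t => ?_,
    by simp, by simpa using hk.ne', by simpa using hkc⟩
  · simpa [mul_comm] using ((hasDerivAt_id t).const_mul k).sinh
  · exact ((((hasDerivAt_id t).const_mul k).cosh).const_mul k).congr_deriv (by simp; ring)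

theorem fderivWithin_strip_mul {X Y : ℝ → ℝ} {p : ℝ × ℝ} {a b : ℝ} (hp : p ∈ strip)
    (hX : HasDerivAt X a p.1) (hY : HasDerivAt Y b p.2) {f : ℝ × ℝ → ℝ}
    (hf : EqOn f (fun q => X q.1 * Y q.2) strip) (v : ℝ × ℝ) :
    fderivWithin ℝ f strip p v = v.1 * (a * Y p.2) + v.2 * (X p.1 * b) := by
  have h : HasFDerivAt (fun q : ℝ × ℝ => X q.1 * Y q.2) _ p :=
    (hX.comp_hasFDerivAt p (hasFDerivAt_fst (𝕜 := ℝ) (p := p))).mul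
      (hY.comp_hasFDerivAt p (hasFDerivAt_snd (𝕜 := ℝ) (p := p)))
  rw [fderivWithin_congr hf (hf hp),
    h.hasFDerivWithinAt.fderivWithin (uniqueDiffOn_strip p hp)]
  simp
  ring

theorem pdx_mul {X Y : ℝ → ℝ} {p : ℝ × ℝ} {a b : ℝ} (hp : p ∈ strip) (hX : HasDerivAt X a p.1)
    (hY : HasDerivAt Y b p.2) {f : ℝ × ℝ → ℝ} (hf : EqOn f (fun q => X q.1 * Y q.2) strip) :
    pdx f p = a * Y p.2 := by
  simp [pdx, fderivWithin_strip_mul hp hX hY hf]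

theorem pdy_mul {X Y : ℝ → ℝ} {p : ℝ × ℝ} {a b : ℝ} (hp : p ∈ strip) (hX : HasDerivAt X a p.1)
    (hY : HasDerivAt Y b p.2) {f : ℝ × ℝ → ℝ} (hf : EqOn f (fun q => X q.1 * Y q.2) strip) :
    pdy f p = X p.1 * b := by
  simp [pdy, fderivWithin_strip_mul hp hX hY hf]

theorem norm_le_abs_add_abs (L : ℝ × ℝ →L[ℝ] ℝ) : ‖L‖ ≤ |L (1, 0)| + |L (0, 1)| := by
  refine L.opNorm_le_bound (by positivity) fun v => ?_
  have hv : L v = v.1 * L (1, 0) + v.2 * L (0, 1) := by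
    rw [← smul_eq_mul, ← smul_eq_mul, ← map_smul, ← map_smul, ← map_add]
    simp
  rw [hv, Real.norm_eq_abs]
  calc |v.1 * L (1, 0) + v.2 * L (0, 1)| ≤ |v.1| * |L (1, 0)| + |v.2| * |L (0, 1)| := by
        rw [← abs_mul, ← abs_mul]
        exact abs_add_le _ _
    _ ≤ ‖v‖ * |L (1, 0)| + ‖v‖ * |L (0, 1)| := by
        gcongr
        · exact norm_fst_le v
        · exact norm_snd_le v
    _ = (|L (1, 0)| + |L (0, 1)|) * ‖v‖ := by ring

/-- Separated solutions of the Laplace equation in the strip. -/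
theorem separated_mode (A k : ℝ) {Y Y' : ℝ → ℝ} (hYc : ContDiff ℝ 2 Y)
    (hY : ∀ t, HasDerivAt Y (Y' t) t) (hY' : ∀ t, HasDerivAt Y' (k ^ 2 * Y t) t) :
    ContDiff ℝ 2 (fun p : ℝ × ℝ => A * Real.cos (k * p.1) * Y p.2) ∧
    (∃ K, ∀ p ∈ strip, |A * Real.cos (k * p.1) * Y p.2| ≤ K ∧
      ‖fderivWithin ℝ (fun p : ℝ × ℝ => A * Real.cos (k * p.1) * Y p.2) strip p‖ ≤ K) ∧
    (∀ p ∈ stripO, pdx (pdx fun p => A * Real.cos (k * p.1) * Y p.2) p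
      + pdy (pdy fun p => A * Real.cos (k * p.1) * Y p.2) p = 0) ∧
    ∀ p ∈ strip, pdy (fun p => A * Real.cos (k * p.1) * Y p.2) p
      = A * Real.cos (k * p.1) * Y' p.2 := by
  have hX (t : ℝ) : HasDerivAt (fun t => A * Real.cos (k * t)) (-(A * k) * Real.sin (k * t)) t :=
    ((((hasDerivAt_id t).const_mul k).cos).const_mul A).congr_deriv (by simp; ring)
  have hX' (t : ℝ) : HasDerivAt (fun t => -(A * k) * Real.sin (k * t))
      (-(k ^ 2 * (A * Real.cos (k * t)))) t :=
    ((((hasDerivAt_id t).const_mul k).sin).const_mul (-(A * k))).congr_deriv (by simp; ring)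
  have hpx : EqOn (pdx fun p => A * Real.cos (k * p.1) * Y p.2)
      (fun p => -(A * k) * Real.sin (k * p.1) * Y p.2) strip :=
    fun p hp => pdx_mul (X := fun t => A * Real.cos (k * t)) hp (hX p.1) (hY p.2) fun _ _ => rfl
  have hpy : EqOn (pdy fun p => A * Real.cos (k * p.1) * Y p.2)
      (fun p => A * Real.cos (k * p.1) * Y' p.2) strip :=
    fun p hp => pdy_mul (X := fun t => A * Real.cos (k * t)) hp (hX p.1) (hY p.2) fun _ _ => rfl
  refine ⟨(contDiff_const.mul (Real.contDiff_cos.comp (contDiff_const.mul contDiff_fst))).mul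
    (hYc.comp contDiff_snd), ?_, fun p hp => ?_, hpy⟩
  · obtain ⟨C, hC⟩ := isCompact_Icc.exists_bound_of_continuousOn (s := Icc (0 : ℝ) 1)
      hYc.continuous.continuousOn
    obtain ⟨C', hC'⟩ := isCompact_Icc.exists_bound_of_continuousOn (s := Icc (0 : ℝ) 1)
      (f := Y') (fun t _ => (hY' t).continuousAt.continuousWithinAt)
    have hC0 : 0 ≤ C := (norm_nonneg _).trans (hC 0 (by simp))
    have hC0' : 0 ≤ C' := (norm_nonneg _).trans (hC' 0 (by simp))
    have key (a s b D : ℝ) (hs : |s| ≤ 1) (hb : |b| ≤ D) : |a * s * b| ≤ |a| * D := by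
      rw [abs_mul, abs_mul]
      have : |a| * |s| ≤ |a| := mul_le_of_le_one_right (abs_nonneg a) hs
      exact mul_le_mul this hb (abs_nonneg _) (abs_nonneg _)
    refine ⟨|A| * C + |-(A * k)| * C + |A| * C', fun p hp => ⟨?_, ?_⟩⟩
    · refine (key A _ _ C (Real.abs_cos_le_one _) (hC p.2 hp)).trans ?_
      have h1 : 0 ≤ |-(A * k)| * C := by positivity
      have h2 : 0 ≤ |A| * C' := by positivity
      linarith
    · refine (norm_le_abs_add_abs _).trans ?_
      have h1 := key (-(A * k)) _ _ C (Real.abs_sin_le_one (k * p.1)) (hC p.2 hp)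
      have h2 := key A _ _ C' (Real.abs_cos_le_one (k * p.1)) (hC' p.2 hp)
      have h3 : 0 ≤ |A| * C := by positivity
      have e1 := hpx hp
      have e2 := hpy hp
      simp only [pdx, pdy] at e1 e2
      rw [e1, e2]
      linarith
  · rw [pdx_mul (X := fun t => -(A * k) * Real.sin (k * t)) (stripO_subset_strip hp) (hX' p.1)
      (hY p.2) hpx, pdy_mul (X := fun t => A * Real.cos (k * t)) (stripO_subset_strip hp)
      (hX p.1) (hY' p.2) hpy]
    ring

/-- Triviality of the kernel of the linearized operator: for real `γ`, `α` and `ε₁ > 0`,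
every triple `(w₁, w₂, w₃)` of bounded functions with bounded first-order partial
derivatives, continuously differentiable on the closed strip, harmonic in `R`, vanishing
on `B` and satisfying on `Γ` the linearized conditions `γw₁ + w₂ = 0`,
`∂_y w₂ + (γ − 1 − ε₁)∂_y w₁ + (γ + α)w₁ + ε₁∂_y w₃ = 0` and `w₃ = 0`, is identically
zero if and only if `α < 1 − γ + ε₁`. -/
theorem stmt_8 (γ α ε₁ : ℝ) (hε₁ : 0 < ε₁) :
    (∀ w₁ w₂ w₃ : ℝ × ℝ → ℝ,
      ContDiffOn ℝ 1 w₁ strip → ContDiffOn ℝ 1 w₂ strip → ContDiffOn ℝ 1 w₃ strip →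
      (∃ K : ℝ, ∀ p ∈ strip,
        |w₁ p| ≤ K ∧ |w₂ p| ≤ K ∧ |w₃ p| ≤ K ∧
        ‖fderivWithin ℝ w₁ strip p‖ ≤ K ∧ ‖fderivWithin ℝ w₂ strip p‖ ≤ K ∧
        ‖fderivWithin ℝ w₃ strip p‖ ≤ K) →
      ContDiffOn ℝ 2 w₁ stripO → ContDiffOn ℝ 2 w₂ stripO → ContDiffOn ℝ 2 w₃ stripO →
      (∀ p ∈ stripO, pdx (pdx w₁) p + pdy (pdy w₁) p = 0) →
      (∀ p ∈ stripO, pdx (pdx w₂) p + pdy (pdy w₂) p = 0) →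
      (∀ p ∈ stripO, pdx (pdx w₃) p + pdy (pdy w₃) p = 0) →
      (∀ x : ℝ, w₁ (x, 0) = 0 ∧ w₂ (x, 0) = 0 ∧ w₃ (x, 0) = 0) →
      (∀ x : ℝ, γ * w₁ (x, 1) + w₂ (x, 1) = 0) →
      (∀ x : ℝ, pdy w₂ (x, 1) + (γ - 1 - ε₁) * pdy w₁ (x, 1)
          + (γ + α) * w₁ (x, 1) + ε₁ * pdy w₃ (x, 1) = 0) →
      (∀ x : ℝ, w₃ (x, 1) = 0) →
      ∀ p ∈ strip, w₁ p = 0 ∧ w₂ p = 0 ∧ w₃ p = 0)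
    ↔ α < 1 - γ + ε₁ := by
  constructor
  · intro h
    by_contra! hα
    have hpos : 0 < 1 + ε₁ := by linarith
    obtain ⟨k, Y, Y', hYc, hY, hY', hY0, hY1, hYr⟩ :=
      exists_transversal_mode (c := (γ + α) / (1 + ε₁)) ((one_le_div hpos).2 (by linarith))
    obtain ⟨c1, ⟨K₁, b1⟩, l1, d1⟩ := separated_mode 1 k hYc hY hY'
    obtain ⟨c2, ⟨K₂, b2⟩, l2, d2⟩ := separated_mode (-γ) k hYc hY hY'
    obtain ⟨c3, ⟨K₃, b3⟩, l3, d3⟩ := separated_mode 0 k hYc hY hY'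
    have hone (x : ℝ) : (x, (1 : ℝ)) ∈ strip := by simp [strip]
    refine hY1 ?_
    have := (h _ _ _ (c1.of_le (by norm_num)).contDiffOn (c2.of_le (by norm_num)).contDiffOn
      (c3.of_le (by norm_num)).contDiffOn ⟨max K₁ (max K₂ K₃), fun p hp => ?_⟩
      c1.contDiffOn c2.contDiffOn c3.contDiffOn l1 l2 l3 (fun x => by simp [hY0])
      (fun x => by ring) (fun x => ?_) (fun x => by simp) (0, 1) (hone 0)).1
    · simpa using this
    · exact ⟨le_max_of_le_left (b1 p hp).1, le_max_of_le_right (le_max_of_le_left (b2 p hp).1),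
        le_max_of_le_right (le_max_of_le_right (b3 p hp).1), le_max_of_le_left (b1 p hp).2,
        le_max_of_le_right (le_max_of_le_left (b2 p hp).2),
        le_max_of_le_right (le_max_of_le_right (b3 p hp).2)⟩
    · rw [d1 _ (hone x), d2 _ (hone x), d3 _ (hone x), hYr]
      field_simp
      ring
  · intro hα w₁ w₂ w₃ c1 c2 c3 ⟨K, hK⟩ s1 s2 s3 l1 l2 l3 hB hΓ hR hΓ3
    have hpos : 0 < 1 + ε₁ := by linarith
    have H1 := sliceHarmonic_of_contDiffOn s1 l1
    have H2 := sliceHarmonic_of_contDiffOn s2 l2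
    have H3 := sliceHarmonic_of_contDiffOn s3 l3
    have hw3 : ∀ p ∈ strip, w₃ p = 0 :=
      H3.eq_zero c3.continuousOn (fun p hp => (hK p hp).2.2.1) (fun x => (hB x).2.2)
        one_pos (fun x => Or.inl (hΓ3 x))
    have hw2 : ∀ p ∈ strip, γ * w₁ p + w₂ p = 0 := by
      refine (H1.const_mul_add H2 γ).eq_zero (K := |γ| * K + K)
        ((continuousOn_const.mul c1.continuousOn).add c2.continuousOn) (fun p hp => ?_)
        (fun x => by simp [(hB x).1, (hB x).2.1]) one_pos (fun x => Or.inl (hΓ x))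
      refine (abs_add_le _ _).trans (add_le_add ?_ (hK p hp).2.1)
      rw [abs_mul]
      exact mul_le_mul_of_nonneg_left (hK p hp).1 (abs_nonneg γ)
    have hw1 : ∀ p ∈ strip, w₁ p = 0 := by
      refine H1.eq_zero c1.continuousOn (fun p hp => (hK p hp).1) (fun x => (hB x).1)
        (c := (γ + α) / (1 + ε₁)) ((div_lt_one hpos).2 (by linarith)) (fun x => Or.inr ?_)
      have hx : (x, (1 : ℝ)) ∈ strip := by simp [strip]
      have hu : UniqueDiffWithinAt ℝ (Icc (0 : ℝ) 1) 1 :=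
        uniqueDiffOn_Icc one_pos 1 (by simp)
      have e1 := hasDerivWithinAt_pdy (c1.differentiableOn (by norm_num) _ hx)
      have e2 := hasDerivWithinAt_pdy (c2.differentiableOn (by norm_num) _ hx)
      have e3 := hasDerivWithinAt_pdy (c3.differentiableOn (by norm_num) _ hx)
      have z3 : pdy w₃ (x, 1) = 0 := hu.eq_deriv _ e3
        ((hasDerivWithinAt_const 1 _ (0 : ℝ)).congr (fun t ht => hw3 (x, t) ht) (hw3 _ hx))
      have z2 : γ * pdy w₁ (x, 1) + pdy w₂ (x, 1) = 0 :=
        hu.eq_deriv _ ((e1.const_mul γ).add e2)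
          ((hasDerivWithinAt_const 1 _ (0 : ℝ)).congr (fun t ht => hw2 (x, t) ht) (hw2 _ hx))
      have hval : pdy w₁ (x, 1) = (γ + α) / (1 + ε₁) * w₁ (x, 1) := by
        rw [div_mul_eq_mul_div, eq_div_iff hpos.ne']
        linear_combination -(hR x) + z2 + ε₁ * z3
      exact hval ▸ e1
    intro p hp
    refine ⟨hw1 p hp, ?_, hw3 p hp⟩
    simpa [hw1 p hp] using hw2 p hp
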